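/- Let M be an abelian group. Then there exists a group G such that the abelianization G/[G,G] is isomorphic to M, and the commutator subgroup [G,G] is a superperfect strongly torsion generated group with trivial centre (i.e. H_1([G,G]) = 0, H_2([G,G]) = 0, [G,G] is strongly torsion generated, and the centre of [G,G] is trivial). -/

import Mathlib

open CategoryTheory AlgebraicTopology

/-- The chain complex (over `ℤ`) associated to the nerve of the one-object groupoid on a
group `G`, i.e. the simplicial chain complex of the classifying space `BG`; its homology in
positive degrees is the integral group homology of `G`. -/
noncomputable def classifyingComplex (G : Type) [Group G] : ChainComplex (ModuleCat ℤ) ℕ :=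
  (alternatingFaceMapComplex (ModuleCat ℤ)).obj
    (((SimplicialObject.whiskering (Type) (ModuleCat ℤ)).obj (ModuleCat.free ℤ)).obj
      (nerve (SingleObj G)))

/-- The integral group homology `H_n(G; ℤ)` of a group `G`. -/
noncomputable def grpHomology (G : Type) [Group G] (n : ℕ) : ModuleCat ℤ :=
  (classifyingComplex G).homology n

/-- A group `G` is strongly torsion generated if for every `n ≥ 2` there is an element of
order exactly `n` whose normal closure is all of `G`. -/
def StronglyTorsionGenerated (G : Type*) [Group G] : Prop :=
  ∀ n : ℕ, 2 ≤ n → ∃ g : G, orderOf g = n ∧ Subgroup.normalClosure {g} = ⊤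

section PermPart
open Equiv
open scoped commutatorElement

/-- Acting by `g` on the copies with positive index. -/
def posAct (A : Type) : Perm A →* Perm (A × ℤ) where
  toFun g :=
    { toFun := fun p => if 1 ≤ p.2 then (g p.1, p.2) else p
      invFun := fun p => if 1 ≤ p.2 then (g⁻¹ p.1, p.2) else p
      left_inv := by
        rintro ⟨a, k⟩
        by_cases h : 1 ≤ k <;> simp [h]
      right_inv := by
        rintro ⟨a, k⟩
        by_cases h : 1 ≤ k <;> simp [h] }
  map_one' := by
    ext p <;> simp
  map_mul' g h := by
    ext ⟨a, k⟩ <;> by_cases h : 1 ≤ k <;> simp [h]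

theorem posAct_apply (A : Type) (g : Perm A) (a : A) (k : ℤ) :
    posAct A g (a, k) = if 1 ≤ k then (g a, k) else (a, k) := rfl

/-- Acting by `g` on the copy zero. -/
def zeroAct (A : Type) (g : Perm A) : Perm (A × ℤ) where
  toFun := fun p => if p.2 = 0 then (g p.1, p.2) else p
  invFun := fun p => if p.2 = 0 then (g⁻¹ p.1, p.2) else p
  left_inv := by
    rintro ⟨a, k⟩
    by_cases h : k = 0 <;> simp [h]
  right_inv := by
    rintro ⟨a, k⟩
    by_cases h : k = 0 <;> simp [h]

theorem zeroAct_apply (A : Type) (g : Perm A) (a : A) (k : ℤ) :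
    zeroAct A g (a, k) = if k = 0 then (g a, k) else (a, k) := rfl

/-- Shifting the copies. -/
def shiftPerm (A : Type) : Perm (A × ℤ) where
  toFun p := (p.1, p.2 - 1)
  invFun p := (p.1, p.2 + 1)
  left_inv := by rintro ⟨a, k⟩; simp
  right_inv := by rintro ⟨a, k⟩; simp

theorem shiftPerm_apply (A : Type) (a : A) (k : ℤ) : shiftPerm A (a, k) = (a, k - 1) := rfl

theorem shift_swindle (A : Type) (g : Perm A) :
    shiftPerm A * posAct A g = zeroAct A g * posAct A g * shiftPerm A := by
  refine Equiv.ext ?_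
  rintro ⟨a, k⟩
  simp only [Perm.mul_apply, posAct_apply, shiftPerm_apply]
  rcases lt_trichotomy k 1 with h | h | h
  · rw [if_neg (by lia), if_neg (by lia), shiftPerm_apply, zeroAct_apply, if_neg (by lia)]
  · subst h
    simp [shiftPerm_apply, zeroAct_apply]
  · rw [if_pos (by lia), if_pos (by lia), shiftPerm_apply, zeroAct_apply, if_neg (by lia)]

/-- `σ` is supported in `D`. -/
def Supp (D : Set ℝ) (σ : Perm ℝ) : Prop := ∀ x, x ∉ D → σ x = x

theorem Supp.symm_apply {D : Set ℝ} {σ : Perm ℝ} (h : Supp D σ) {x : ℝ} (hx : x ∉ D) :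
    σ.symm x = x := by
  rw [Equiv.symm_apply_eq, h x hx]

theorem Supp.mem {D : Set ℝ} {σ : Perm ℝ} (h : Supp D σ) {x : ℝ} (hx : x ∈ D) :
    σ x ∈ D := by
  by_contra hc
  have := h.symm_apply hc
  rw [Equiv.symm_apply_apply] at this
  exact hc (this ▸ hx)

theorem Supp.mono {D D' : Set ℝ} (hD : D ⊆ D') {σ : Perm ℝ} (h : Supp D σ) : Supp D' σ :=
  fun x hx => h x (fun hx' => hx (hD hx'))

theorem Supp.commute {D F : Set ℝ} (hDF : Disjoint D F) {σ ρ : Perm ℝ} (h : Supp D σ)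
    (h' : Supp F ρ) : σ * ρ = ρ * σ := by
  refine Equiv.ext fun x => ?_
  simp only [Perm.mul_apply]
  by_cases hx : x ∈ D
  · rw [h' x (Set.disjoint_left.1 hDF hx), h' _ (Set.disjoint_left.1 hDF (h.mem hx))]
  · rw [h x hx]
    by_cases hx' : x ∈ F
    · rw [h _ (Set.disjoint_right.1 hDF (h'.mem hx'))]
    · rw [h' x hx', h x hx]

/-- Countably supported permutations of the reals. -/
def ctblPerm : Subgroup (Perm ℝ) where
  carrier := {σ | ∃ D : Set ℝ, D.Countable ∧ Supp D σ}
  one_mem' := ⟨∅, Set.countable_empty, fun x _ => rfl⟩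
  mul_mem' := by
    rintro σ ρ ⟨D, hD, h⟩ ⟨F, hF, h'⟩
    refine ⟨D ∪ F, hD.union hF, fun x hx => ?_⟩
    rw [Set.mem_union, not_or] at hx
    rw [Perm.mul_apply, h' x hx.2, h x hx.1]
  inv_mem' := by
    rintro σ ⟨D, hD, h⟩
    exact ⟨D, hD, fun x hx => h.symm_apply hx⟩

theorem via_supp {β : Type} (e : β ↪ ℝ) (σ : Perm β) : Supp (Set.range e) (Perm.viaEmbedding σ e) :=
  fun _ hx => Perm.viaEmbedding_apply_of_notMem _ _ _ hx

theorem exists_emb (β : Type) [Countable β] (F : Set ℝ) (hF : F.Countable) :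
    ∃ e : β ↪ ℝ, ∀ b, e b ∉ F := by
  have h1 : (Fᶜ : Set ℝ).Infinite := by
    intro h
    have : (Set.univ : Set ℝ).Countable := by
      rw [← Set.union_compl_self F]
      exact hF.union h.countable
    exact Set.not_countable_univ this
  obtain ⟨f, hf⟩ := exists_injective_nat β
  let i := h1.natEmbedding
  refine ⟨⟨fun b => (i (f b) : ℝ), fun a b h => hf (i.injective (Subtype.ext h))⟩, fun b => ?_⟩
  exact (i (f b)).2

theorem exists_cop (A F : Set ℝ) (hA : A.Countable) (hF : F.Countable) (hAF : Disjoint A F) :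
    ∃ e : A × ℤ ↪ ℝ, (∀ a, e (a, 0) = a) ∧ (∀ a k, k ≠ 0 → e (a, k) ∉ A) ∧ ∀ p, e p ∉ F := by
  have := hA.to_subtype
  obtain ⟨e, he⟩ := exists_emb (A × ℤ) (A ∪ F) (hA.union hF)
  have heA : ∀ p, e p ∉ A := fun p h => he p (Or.inl h)
  refine ⟨⟨fun p => if p.2 = 0 then p.1 else e p, ?_⟩, ?_, ?_, ?_⟩
  · rintro ⟨a, k⟩ ⟨b, l⟩ h
    by_cases hk : k = 0 <;> by_cases hl : l = 0 <;> simp only [hk, hl, if_true, if_false] at h ⊢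
    · rw [Subtype.ext h]
    · exact (heA _ (h ▸ a.2)).elim
    · exact (heA _ (h ▸ b.2)).elim
    · exact e.injective h
  · intro a
    change (if (0 : ℤ) = 0 then (a : ℝ) else e (a, 0)) = a
    exact if_pos rfl
  · intro a k hk
    change (if k = 0 then (a : ℝ) else e (a, k)) ∉ A
    simpa [hk] using heA (a, k)
  · rintro ⟨a, k⟩
    change (if k = 0 then (a : ℝ) else e (a, k)) ∉ F
    by_cases hk : k = 0
    · simpa [hk] using Set.disjoint_left.1 hAF a.2
    · simpa [hk] using fun h => he (a, k) (Or.inr h)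

theorem via_mul {β : Type} (e : β ↪ ℝ) (σ ρ : Perm β) :
    Perm.viaEmbedding (σ * ρ) e = Perm.viaEmbedding σ e * Perm.viaEmbedding ρ e :=
  (Perm.viaEmbeddingHom e).map_mul σ ρ

/-- The swindle. -/
theorem swindle (A F : Set ℝ) (hA : A.Countable) (hF : F.Countable) (hAF : Disjoint A F) :
    ∃ (D : Set ℝ) (τ : Perm A →* Perm ℝ) (t : Perm ℝ), D.Countable ∧ Disjoint D F ∧ Supp D t ∧
      (∀ g, Supp D (τ g)) ∧ (∀ g, Supp (D \ A) (τ g)) ∧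
      ∀ g, ⁅t, τ g⁆ = Perm.viaEmbedding g (Function.Embedding.subtype (· ∈ A)) := by
  obtain ⟨e, he0, heA, heF⟩ := exists_cop A F hA hF hAF
  have := hA.to_subtype
  refine ⟨Set.range e, (Perm.viaEmbeddingHom e).comp (posAct A), Perm.viaEmbedding (shiftPerm A) e,
    Set.countable_range e, ?_, via_supp _ _, fun g => via_supp _ _, ?_, ?_⟩
  · rw [Set.disjoint_left]
    rintro _ ⟨p, rfl⟩
    exact heF p
  · intro g x hx
    by_cases hr : x ∈ Set.range e
    · obtain ⟨⟨a, k⟩, rfl⟩ := hr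
      have hk : k = 0 := by
        by_contra hk
        exact hx ⟨⟨_, rfl⟩, heA a k hk⟩
      subst hk
      change Perm.viaEmbedding (posAct A g) e (e (a, 0)) = _
      rw [Perm.viaEmbedding_apply]
      simp [posAct_apply]
    · exact via_supp e _ x hr
  · intro g
    have h1 : Perm.viaEmbedding g (Function.Embedding.subtype (· ∈ A)) =
        Perm.viaEmbedding (zeroAct A g) e := by
      refine Equiv.ext fun x => ?_
      by_cases hx : x ∈ A
      · have h2 := Perm.viaEmbedding_apply g (Function.Embedding.subtype (· ∈ A)) ⟨x, hx⟩
        have h3 := Perm.viaEmbedding_apply (zeroAct A g) e (⟨x, hx⟩, 0)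
        rw [zeroAct_apply, if_pos rfl, he0, he0] at h3
        exact h2.trans h3.symm
      · rw [Perm.viaEmbedding_apply_of_notMem _ _ _ (by simpa using hx)]
        by_cases hr : x ∈ Set.range e
        · obtain ⟨⟨a, k⟩, rfl⟩ := hr
          have hk : k ≠ 0 := by
            rintro rfl
            rw [he0] at hx
            exact hx a.2
          rw [Perm.viaEmbedding_apply, zeroAct_apply, if_neg hk]
        · exact (via_supp e _ x hr).symm
    rw [h1, commutatorElement_def]
    change Perm.viaEmbedding (shiftPerm A) e * Perm.viaEmbedding (posAct A g) e * _ * _ = _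
    rw [← via_mul, shift_swindle, via_mul, via_mul]
    rw [mul_inv_cancel_right]
    exact mul_inv_cancel_right _ _

theorem exists_restrict {A : Set ℝ} {σ : Perm ℝ} (h : Supp A σ) :
    ∃ g : Perm A, Perm.viaEmbedding g (Function.Embedding.subtype (· ∈ A)) = σ := by
  have hm : ∀ x, x ∈ A ↔ σ x ∈ A := fun x =>
    ⟨h.mem, fun hx => by_contra fun hc => hc (h x hc ▸ hx)⟩
  refine ⟨σ.subtypePerm (fun x => (hm x).symm), Equiv.ext fun x => ?_⟩
  by_cases hx : x ∈ A
  · exact Perm.viaEmbedding_apply _ (Function.Embedding.subtype (· ∈ A)) ⟨x, hx⟩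
  · rw [Perm.viaEmbedding_apply_of_notMem _ _ _ (by simpa using hx), h x hx]

/-- Moving a countable set into a disjoint infinite set. -/
theorem exists_move {B C : Set ℝ} (hB : B.Countable) (hC : C.Infinite) (hBC : Disjoint B C) :
    ∃ k ∈ ctblPerm, ∀ x ∈ B, k x ∈ C := by
  have := hB.to_subtype
  obtain ⟨f, hf⟩ := exists_injective_nat B
  let i := hC.natEmbedding
  let e : B ⊕ B ↪ ℝ := ⟨Sum.elim (fun b => b) (fun b => (i (f b) : ℝ)), by
    rintro (a | a) (b | b) h <;> simp only [Sum.elim_inl, Sum.elim_inr] at h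
    · rw [Subtype.ext h]
    · exact (Set.disjoint_left.1 hBC a.2 (h ▸ (i (f b)).2)).elim
    · exact (Set.disjoint_left.1 hBC b.2 (h ▸ (i (f a)).2)).elim
    · rw [hf (i.injective (Subtype.ext h))]⟩
  refine ⟨Perm.viaEmbedding (Equiv.sumComm B B) e, ⟨_, Set.countable_range e, via_supp _ _⟩, ?_⟩
  intro x hx
  have := Perm.viaEmbedding_apply (Equiv.sumComm B B) e (Sum.inl ⟨x, hx⟩)
  change Perm.viaEmbedding (Equiv.sumComm B B) e x = i (f ⟨x, hx⟩) at this
  rw [this]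
  exact (i _).2

theorem exists_move' {B C : Set ℝ} (hB : B.Countable) (hC : C.Infinite) (hC' : C.Countable) :
    ∃ k ∈ ctblPerm, ∀ x ∈ B, k x ∈ C := by
  obtain ⟨e, he⟩ := exists_emb ℕ (B ∪ C) (hB.union hC')
  have hD : (Set.range e).Infinite := Set.infinite_range_of_injective e.injective
  obtain ⟨k, hk, h1⟩ := exists_move hB hD (by
    rw [Set.disjoint_right]; rintro _ ⟨n, rfl⟩ h; exact he n (Or.inl h))
  obtain ⟨l, hl, h2⟩ := exists_move (Set.countable_range e) hC (by
    rw [Set.disjoint_left]; rintro _ ⟨n, rfl⟩ h; exact he n (Or.inr h))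
  exact ⟨l * k, mul_mem hl hk, fun x hx => h2 _ (h1 x hx)⟩

theorem supp_conj {B C : Set ℝ} {k σ : Perm ℝ} (hk : ∀ x ∈ B, k x ∈ C) (h : Supp B σ) :
    Supp C (k * σ * k⁻¹) := by
  intro x hx
  have : k⁻¹ x ∉ B := fun hb => hx (by simpa using hk _ hb)
  simp only [Perm.mul_apply]
  rw [h _ this]; simp

/-- Higman's trick: the normal closure of an element moving an infinite set off itself. -/
theorem normal_eq_top (N : Subgroup ctblPerm) [N.Normal] (g : ctblPerm) (hg : g ∈ N) (C : Set ℝ)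
    (hC : C.Infinite) (hC' : C.Countable) (hgC : ∀ x ∈ C, (g : Perm ℝ) x ∉ C) : N = ⊤ := by
  have key : ∀ x y : ctblPerm, Supp C x → Supp C y → ⁅x, y⁆ ∈ N := by
    intro x y hx hy
    have hgy : Supp ((g : Perm ℝ) '' C) ((g : Perm ℝ) * (y : Perm ℝ)⁻¹ * (g : Perm ℝ)⁻¹) :=
      supp_conj (fun x hx => ⟨x, hx, rfl⟩) (fun x hx => hy.symm_apply hx)
    have hd : Disjoint C ((g : Perm ℝ) '' C) := by
      rw [Set.disjoint_right]; rintro _ ⟨z, hz, rfl⟩; exact hgC z hz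
    have hcomm : x * (g * y⁻¹ * g⁻¹) = (g * y⁻¹ * g⁻¹) * x :=
      Subtype.ext (Supp.commute hd hx hgy)
    have h1 : ⁅y, g⁆ ∈ N := by
      rw [commutatorElement_def]
      exact mul_mem (‹N.Normal›.conj_mem g hg y) (inv_mem hg)
    have h2 : ⁅x, ⁅y, g⁆⁆ ∈ N := by
      rw [commutatorElement_def]
      exact mul_mem (‹N.Normal›.conj_mem _ h1 x) (inv_mem h1)
    have h3 : ⁅x, ⁅y, g⁆⁆ = ⁅x, y⁆ := by
      have e1 : ⁅y, g⁆ = y * (g * y⁻¹ * g⁻¹) := by rw [commutatorElement_def]; group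
      rw [e1]
      generalize g * y⁻¹ * g⁻¹ = w at hcomm
      calc ⁅x, y * w⁆ = x * y * (w * x⁻¹) * w⁻¹ * y⁻¹ := by rw [commutatorElement_def]; group
        _ = x * y * (x⁻¹ * w) * w⁻¹ * y⁻¹ := by
          rw [show w * x⁻¹ = x⁻¹ * w by
            rw [eq_inv_mul_iff_mul_eq, ← mul_assoc, hcomm, mul_assoc, mul_inv_cancel, mul_one]]
        _ = ⁅x, y⁆ := by rw [commutatorElement_def]; group
    rw [← h3]; exact h2
  rw [eq_top_iff]
  rintro ⟨σ, A, hA, hσ⟩ -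
  obtain ⟨D, τ, t, hD, -, ht, hτ, -, hc⟩ := swindle A ∅ hA Set.countable_empty (by simp)
  obtain ⟨h, hh⟩ := exists_restrict hσ
  obtain ⟨k, hk, hkD⟩ := exists_move' hD hC hC'
  let K : ctblPerm := ⟨k, hk⟩
  let T : ctblPerm := ⟨t, D, hD, ht⟩
  let S : ctblPerm := ⟨τ h, D, hD, hτ h⟩
  have h1 := key (K * T * K⁻¹) (K * S * K⁻¹) (supp_conj hkD ht) (supp_conj hkD (hτ h))
  have h2 := ‹N.Normal›.conj_mem _ h1 K⁻¹
  have h3 : K⁻¹ * ⁅K * T * K⁻¹, K * S * K⁻¹⁆ * K⁻¹⁻¹ = ⁅T, S⁆ := by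
    simp only [commutatorElement_def]; group
  rw [h3] at h2
  have h4 : ⁅T, S⁆ = ⟨σ, A, hA, hσ⟩ := Subtype.ext ((hc h).trans hh)
  rw [← h4]; exact h2

/-- Cyclic shifts on infinitely many copies of `ZMod n`. -/
def cycHom (n : ℕ) : Multiplicative (ZMod n) →* Perm (ℕ × ZMod n) where
  toFun z :=
    { toFun := fun p => (p.1, z.toAdd + p.2)
      invFun := fun p => (p.1, -z.toAdd + p.2)
      left_inv := by rintro ⟨a, b⟩; simp
      right_inv := by rintro ⟨a, b⟩; simp }
  map_one' := by ext p <;> simp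
  map_mul' x y := by ext p <;> simp [add_assoc]

theorem cycHom_apply (n : ℕ) (z : Multiplicative (ZMod n)) (a : ℕ) (b : ZMod n) :
    cycHom n z (a, b) = (a, z.toAdd + b) := rfl

theorem ctbl_stg : StronglyTorsionGenerated ctblPerm := by
  intro n hn
  have : NeZero n := ⟨by lia⟩
  have : Fact (1 < n) := ⟨hn⟩
  obtain ⟨e, -⟩ := exists_emb (ℕ × ZMod n) ∅ Set.countable_empty
  let u := cycHom n (Multiplicative.ofAdd 1)
  let g : ctblPerm := ⟨Perm.viaEmbedding u e, _, Set.countable_range e, via_supp _ _⟩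
  refine ⟨g, ?_, ?_⟩
  · rw [← Subgroup.orderOf_coe]
    change orderOf (Perm.viaEmbeddingHom e u) = n
    rw [orderOf_injective _ (Perm.viaEmbeddingHom_injective e), orderOf_injective, orderOf_ofAdd_eq_addOrderOf,
      ZMod.addOrderOf_one]
    intro x y h
    have := congrArg (fun s : Perm (ℕ × ZMod n) => (s (0, 0)).2) h
    simpa [cycHom_apply] using this
  · refine normal_eq_top _ g (Subgroup.subset_normalClosure rfl)
      (Set.range (fun a : ℕ => e (a, 0))) ?_ (Set.countable_range _) ?_
    · exact Set.infinite_range_of_injective (fun a b h => by simpa using e.injective h)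
    · rintro _ ⟨a, rfl⟩ ⟨b, h⟩
      change e (b, 0) = Perm.viaEmbedding u e (e (a, 0)) at h
      rw [Perm.viaEmbedding_apply] at h
      have := congrArg Prod.snd (e.injective h)
      simp [u, cycHom_apply] at this

theorem ctbl_commutator (σ : ctblPerm) : σ ∈ commutator ctblPerm := by
  obtain ⟨σ, A, hA, hσ⟩ := σ
  obtain ⟨D, τ, t, hD, -, ht, hτ, -, hc⟩ := swindle A ∅ hA Set.countable_empty (by simp)
  obtain ⟨h, hh⟩ := exists_restrict hσ
  let T : ctblPerm := ⟨t, D, hD, ht⟩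
  let S : ctblPerm := ⟨τ h, D, hD, hτ h⟩
  have h4 : ⁅T, S⁆ = ⟨σ, A, hA, hσ⟩ := Subtype.ext ((hc h).trans hh)
  rw [← h4]
  exact Subgroup.commutator_mem_commutator trivial trivial

theorem ctbl_center : Subgroup.center ctblPerm = ⊥ := by
  rw [eq_bot_iff]
  intro σ hσ
  rw [Subgroup.mem_bot]
  refine Subtype.ext (Equiv.ext fun x => ?_)
  change (σ : Perm ℝ) x = x
  by_contra hx
  obtain ⟨e, he⟩ := exists_emb Unit {x, (σ : Perm ℝ) x} (Set.countable_singleton _ |>.insert _)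
  have hy := he ()
  set y := e ()
  simp only [Set.mem_insert_iff, Set.mem_singleton_iff, not_or] at hy
  have hs : Supp {(σ : Perm ℝ) x, y} (swap ((σ : Perm ℝ) x) y) := by
    intro z hz
    simp only [Set.mem_insert_iff, Set.mem_singleton_iff, not_or] at hz
    exact swap_apply_of_ne_of_ne hz.1 hz.2
  have h1 := Subgroup.mem_center_iff.1 hσ ⟨_, _, (Set.countable_singleton _ |>.insert _), hs⟩
  have h2 := congrArg (fun s : ctblPerm => (s : Perm ℝ) x) h1
  simp only [Subgroup.coe_mul, Perm.mul_apply, swap_apply_left] at h2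
  rw [swap_apply_of_ne_of_ne (Ne.symm hx) (Ne.symm hy.1)] at h2
  exact hy.2 h2

theorem lift_commute {E : Type} [Group E] (p : E →* ctblPerm) (hp : Function.Surjective p)
    (hz : ∀ z, p z = 1 → ∀ x, z * x = x * z) {A F : Set ℝ} (hA : A.Countable) (hF : F.Countable)
    (hAF : Disjoint A F) (x y : E) (hx : Supp A (p x)) (hy : Supp F (p y)) : x * y = y * x := by
  obtain ⟨D, τ, t, hD, hDF, ht, hτ, -, hc⟩ := swindle A F hA hF hAF
  obtain ⟨h, hh⟩ := exists_restrict hx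
  obtain ⟨a, ha⟩ := hp ⟨t, D, hD, ht⟩
  obtain ⟨b, hb⟩ := hp ⟨τ h, D, hD, hτ h⟩
  have central : ∀ a : E, Supp D (p a) → ∃ z, (∀ x, z * x = x * z) ∧ a * y = z * (y * a) := by
    intro a ha
    refine ⟨a * y * (y * a)⁻¹, hz _ ?_, by group⟩
    rw [map_mul, map_inv, mul_inv_eq_one, map_mul, map_mul]
    exact Subtype.ext (Supp.commute hDF ha hy)
  obtain ⟨z₁, hz₁, e₁⟩ := central a (by rw [ha]; exact ht)
  obtain ⟨z₂, hz₂, e₂⟩ := central b (by rw [hb]; exact hτ h)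
  have hc' : p (x * ⁅a, b⁆⁻¹) = 1 := by
    rw [map_mul, map_inv, mul_inv_eq_one, map_commutatorElement, ha, hb]
    exact Subtype.ext ((hc h).trans hh).symm
  have hw := hz _ hc'
  have hab : ⁅a, b⁆ * y = y * ⁅a, b⁆ := by
    have f1 : y⁻¹ * a * y = z₁ * a := by
      rw [mul_assoc, e₁, ← mul_assoc, ← hz₁, mul_assoc]; group
    have f2 : y⁻¹ * b * y = z₂ * b := by
      rw [mul_assoc, e₂, ← mul_assoc, ← hz₂, mul_assoc]; group
    have : y⁻¹ * ⁅a, b⁆ * y = ⁅y⁻¹ * a * y, y⁻¹ * b * y⁆ := by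
      simp only [commutatorElement_def]; group
    have f3 : ⁅z₁ * a, z₂ * b⁆ = ⁅a, b⁆ := by
      calc ⁅z₁ * a, z₂ * b⁆ = z₁ * (a * z₂) * b * a⁻¹ * (z₁⁻¹ * b⁻¹) * z₂⁻¹ := by
            simp only [commutatorElement_def]; group
        _ = z₁ * (z₂ * a) * b * a⁻¹ * (b⁻¹ * z₁⁻¹) * z₂⁻¹ := by
            rw [hz₂ a, show z₁⁻¹ * b⁻¹ = b⁻¹ * z₁⁻¹ by rw [← mul_inv_rev, ← mul_inv_rev, hz₁]]
        _ = (z₁ * z₂) * (⁅a, b⁆ * (z₂ * z₁)⁻¹) := by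
            simp only [commutatorElement_def]; group
        _ = ⁅a, b⁆ := by
            rw [hz₂ z₁, ← mul_assoc, mul_assoc z₁, hz₂, ← mul_assoc z₁, hz₁]; group
    rw [f1, f2, f3] at this
    rwa [mul_assoc, inv_mul_eq_iff_eq_mul] at this
  calc x * y = (x * ⁅a, b⁆⁻¹) * (⁅a, b⁆ * y) := by rw [← mul_assoc, inv_mul_cancel_right]
    _ = (x * ⁅a, b⁆⁻¹) * y * ⁅a, b⁆ := by rw [hab, ← mul_assoc]
    _ = y * x := by rw [hw, mul_assoc, inv_mul_cancel_right]

/-- Central extensions of `ctblPerm` split over the permutations supported in a countable set. -/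
theorem exists_split {E : Type} [Group E] (p : E →* ctblPerm) (hp : Function.Surjective p)
    (hz : ∀ z, p z = 1 → ∀ x, z * x = x * z) {A : Set ℝ} (hA : A.Countable) :
    ∃ s : ctblPerm → E, (∀ g : ctblPerm, Supp A g → p (s g) = g) ∧
      ∀ g h : ctblPerm, Supp A g → Supp A h → s (g * h) = s g * s h := by
  obtain ⟨D, τ, t, hD, hDF, ht, hτ, hτ', hc⟩ := swindle A ∅ hA Set.countable_empty (by simp)
  obtain ⟨a, ha⟩ := hp ⟨t, D, hD, ht⟩
  choose l hl using fun h : Perm A => hp ⟨τ h, D, hD, hτ h⟩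
  have hs : ∀ h, (p ⁅a, l h⁆ : Perm ℝ) =
      Perm.viaEmbedding h (Function.Embedding.subtype (· ∈ A)) := by
    intro h
    rw [map_commutatorElement, ha, hl]
    exact hc h
  have hmul : ∀ g h, ⁅a, l (g * h)⁆ = ⁅a, l g⁆ * ⁅a, l h⁆ := by
    intro g h
    have hcen : p (l (g * h) * (l g * l h)⁻¹) = 1 := by
      rw [map_mul, map_inv, mul_inv_eq_one, map_mul, hl, hl, hl]
      exact Subtype.ext (τ.map_mul g h)
    have hw := hz _ hcen
    set w := l (g * h) * (l g * l h)⁻¹ with hwdef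
    have e1 : l (g * h) = w * (l g * l h) := by rw [hwdef]; group
    have hcm : ⁅a, l h⁆ * l g = l g * ⁅a, l h⁆ := by
      refine lift_commute p hp hz hA (hD.mono Set.sdiff_subset) Set.disjoint_sdiff_right _ _ ?_ ?_
      · rw [hs]
        intro x hx
        exact Perm.viaEmbedding_apply_of_notMem _ _ _ (by simpa using hx)
      · rw [hl]; exact hτ' g
    calc ⁅a, l (g * h)⁆ = a * w * (l g * l h) * a⁻¹ * (l g * l h)⁻¹ * w⁻¹ := by
          rw [e1]; simp only [commutatorElement_def]; group
      _ = w * ⁅a, l g * l h⁆ * w⁻¹ := by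
          rw [← hw a]; simp only [commutatorElement_def]; group
      _ = ⁅a, l g * l h⁆ := by rw [hw]; group
      _ = ⁅a, l g⁆ * (l g * ⁅a, l h⁆) * (l g)⁻¹ := by
          simp only [commutatorElement_def]; group
      _ = _ := by rw [← hcm]; group
  classical
  choose r hr using fun (g : ctblPerm) (hg : Supp A g) => exists_restrict hg
  refine ⟨fun g => if hg : Supp A g then ⁅a, l (r g hg)⁆ else 1, ?_, ?_⟩
  · intro g hg
    dsimp only
    rw [dif_pos hg]
    exact Subtype.ext ((hs _).trans (hr g hg))
  · intro g h hg hh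
    have hgh : Supp A ((g * h : ctblPerm) : Perm ℝ) := by
      intro x hx
      change (g : Perm ℝ) ((h : Perm ℝ) x) = x
      rw [hh x hx, hg x hx]
    dsimp only
    rw [dif_pos hg, dif_pos hh, dif_pos hgh, ← hmul]
    congr 2
    apply Perm.viaEmbeddingHom_injective (Function.Embedding.subtype (· ∈ A))
    rw [map_mul]
    exact (hr _ hgh).trans (congrArg₂ (· * ·) (hr g hg).symm (hr h hh).symm)

end PermPart

section HomologyPart
open Opposite Simplicial

variable (L : Type) [Group L]

/-- The edge from vertex `i` to vertex `j`. -/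
def edg {L : Type} [Group L] {n : ℕ} (s : ComposableArrows (SingleObj L) n) (i j : ℕ) (hij : i ≤ j)
    (hj : j ≤ n) : L := s.map' i j hij hj

theorem edg_comp {L : Type} [Group L] {n : ℕ} (s : ComposableArrows (SingleObj L) n) (i j k : ℕ)
    (hij : i ≤ j) (hjk : j ≤ k) (hk : k ≤ n) :
    edg s i k (hij.trans hjk) hk = edg s j k hjk hk * edg s i j hij (hjk.trans hk) :=
  ComposableArrows.map'_comp s i j k hij hjk hk

theorem simplex_ext {L : Type} [Group L] {n : ℕ} (s s' : ComposableArrows (SingleObj L) n)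
    (h : ∀ (i : ℕ) (hi : i < n), edg s i (i + 1) (by lia) hi = edg s' i (i + 1) (by lia) hi) :
    s = s' := by
  refine ComposableArrows.ext (fun i => rfl) ?_
  intro i hi
  refine (h i hi).trans ?_
  exact (mul_one _).symm.trans (congrArg (· * (1 : L)) (one_mul _).symm)

/-- One-simplices. -/
def sx1 (a : L) : ComposableArrows (SingleObj L) 1 :=
  ComposableArrows.mk₁ (X₀ := SingleObj.star L) (X₁ := SingleObj.star L) a
/-- Two-simplices. -/
def sx2 (a b : L) : ComposableArrows (SingleObj L) 2 :=
  ComposableArrows.mk₂ (X₀ := SingleObj.star L) (X₁ := SingleObj.star L) (X₂ := SingleObj.star L) a b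
/-- Three-simplices. -/
def sx3 (a b c : L) : ComposableArrows (SingleObj L) 3 :=
  ComposableArrows.mk₃ (X₀ := SingleObj.star L) (X₁ := SingleObj.star L) (X₂ := SingleObj.star L)
    (X₃ := SingleObj.star L) a b c

theorem sx1_eta (s : ComposableArrows (SingleObj L) 1) :
    s = sx1 L (edg s 0 1 (by lia) (by lia)) := by
  refine simplex_ext _ _ ?_
  intro i hi
  obtain rfl : i = 0 := by lia
  rfl

theorem sx2_eta (s : ComposableArrows (SingleObj L) 2) :
    s = sx2 L (edg s 0 1 (by lia) (by lia)) (edg s 1 2 (by lia) (by lia)) := by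
  refine simplex_ext _ _ ?_
  intro i hi
  obtain rfl | rfl : i = 0 ∨ i = 1 := by lia
  · rfl
  · rfl

/-- The face map, on composable arrows. -/
def fc {L : Type} [Group L] {n : ℕ} (i : Fin (n + 2)) (s : ComposableArrows (SingleObj L) (n + 1)) :
    ComposableArrows (SingleObj L) n := (nerve (SingleObj L)).δ i s

theorem fc2_0 (a b : L) : fc 0 (sx2 L a b) = sx1 L b := by
  rw [sx1_eta L (fc 0 _)]; rfl
theorem fc2_1 (a b : L) : fc 1 (sx2 L a b) = sx1 L (b * a) := by
  rw [sx1_eta L (fc 1 _)]; rfl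
theorem fc2_2 (a b : L) : fc 2 (sx2 L a b) = sx1 L a := by
  rw [sx1_eta L (fc 2 _)]; rfl
theorem fc3_0 (a b c : L) : fc 0 (sx3 L a b c) = sx2 L b c := by
  rw [sx2_eta L (fc 0 _)]; rfl
theorem fc3_1 (a b c : L) : fc 1 (sx3 L a b c) = sx2 L (b * a) c := by
  rw [sx2_eta L (fc 1 _)]; rfl
theorem fc3_2 (a b c : L) : fc 2 (sx3 L a b c) = sx2 L a (c * b) := by
  rw [sx2_eta L (fc 2 _)]; rfl
theorem fc3_3 (a b c : L) : fc 3 (sx3 L a b c) = sx2 L a b := by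
  rw [sx2_eta L (fc 3 _)]; rfl

/-- The chain groups. -/
abbrev Ch (n : ℕ) : Type := ComposableArrows (SingleObj L) n →₀ ℤ

/-- The differential as a linear map. -/
noncomputable def dd (n : ℕ) : Ch L (n + 1) →ₗ[ℤ] Ch L n :=
  ((classifyingComplex L).d (n + 1) n).hom

theorem d_apply (X : SimplicialObject (ModuleCat.{0} ℤ)) (n : ℕ) (x : X.obj (op ⦋n + 1⦌)) :
    ((AlternatingFaceMapComplex.obj X).d (n + 1) n).hom x =
      ∑ i : Fin (n + 2), (-1 : ℤ) ^ (i : ℕ) • (X.δ i).hom x := by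
  have h := congrArg (fun f => ModuleCat.Hom.hom f) (AlternatingFaceMapComplex.obj_d_eq X n)
  have h2 := congrArg (fun f => f x) h
  refine h2.trans ?_
  rw [ModuleCat.hom_sum]
  refine (LinearMap.sum_apply _ _ _).trans ?_
  refine Finset.sum_congr rfl fun i _ => ?_
  rw [ModuleCat.hom_zsmul]
  rfl

theorem dd_single (n : ℕ) (s : ComposableArrows (SingleObj L) (n + 1)) :
    dd L n (Finsupp.single s 1) =
      ∑ i : Fin (n + 2), (-1 : ℤ) ^ (i : ℕ) • Finsupp.single (fc i s) (1 : ℤ) := by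
  refine (d_apply (((SimplicialObject.whiskering (Type) (ModuleCat ℤ)).obj (ModuleCat.free ℤ)).obj
      (nerve (SingleObj L))) n (Finsupp.single s 1)).trans ?_
  refine Finset.sum_congr rfl fun i _ => ?_
  congr 1
  exact ModuleCat.free_map_apply _ _

theorem subsingleton_of_exact (n : ℕ)
    (h : ∀ z : Ch L (n + 1), dd L n z = 0 → ∃ w, dd L (n + 1) w = z) :
    Subsingleton (grpHomology L (n + 1)) := by
  have h1 : (classifyingComplex L).ExactAt (n + 1) := by
    rw [HomologicalComplex.exactAt_iff' _ (n + 2) (n + 1) n (by simp) (by simp),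
      ShortComplex.moduleCat_exact_iff]
    exact h
  exact ModuleCat.subsingleton_of_isZero h1.isZero_homology

theorem dd1 (a b : L) : dd L 1 (Finsupp.single (sx2 L a b) 1) =
    Finsupp.single (sx1 L b) 1 - Finsupp.single (sx1 L (b * a)) 1 + Finsupp.single (sx1 L a) 1 := by
  rw [dd_single, Fin.sum_univ_three, fc2_0, fc2_1, fc2_2]
  simp [sub_eq_add_neg]

theorem dd2 (a b c : L) : dd L 2 (Finsupp.single (sx3 L a b c) 1) =
    Finsupp.single (sx2 L b c) 1 - Finsupp.single (sx2 L (b * a) c) 1 +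
      Finsupp.single (sx2 L a (c * b)) 1 - Finsupp.single (sx2 L a b) 1 := by
  rw [dd_single, Fin.sum_univ_four, fc3_0, fc3_1, fc3_2, fc3_3]
  simp [sub_eq_add_neg, pow_succ]

theorem H1_zero (hL : ∀ g : L, g ∈ commutator L) : Subsingleton (grpHomology L 1) := by
  refine subsingleton_of_exact L 0 fun z _ => ?_
  let R := LinearMap.range (dd L 1)
  have hadd : ∀ a b : L, R.mkQ (Finsupp.single (sx1 L (b * a)) 1) =
      R.mkQ (Finsupp.single (sx1 L b) 1) + R.mkQ (Finsupp.single (sx1 L a) 1) := by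
    intro a b
    have : R.mkQ (dd L 1 (Finsupp.single (sx2 L a b) 1)) = 0 := by
      rw [Submodule.mkQ_apply, Submodule.Quotient.mk_eq_zero]
      exact ⟨_, rfl⟩
    rw [dd1, map_add, map_sub, sub_add_eq_add_sub, sub_eq_zero] at this
    exact this.symm
  let φ : L →* Multiplicative (Ch L 1 ⧸ R) := MonoidHom.mk'
    (fun a => Multiplicative.ofAdd (R.mkQ (Finsupp.single (sx1 L a) 1)))
    (fun b a => congrArg Multiplicative.ofAdd (hadd a b))
  have hφ : ∀ a, R.mkQ (Finsupp.single (sx1 L a) 1) = 0 := fun a =>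
    congrArg Multiplicative.toAdd
      (show φ a = 1 from Abelianization.commutator_subset_ker φ (hL a))
  have : R.mkQ = 0 := by
    refine Finsupp.lhom_ext' fun s => LinearMap.ext_ring ?_
    rw [sx1_eta L s]
    exact hφ _
  have hz : R.mkQ z = 0 := by rw [this]; rfl
  rw [Submodule.mkQ_apply, Submodule.Quotient.mk_eq_zero] at hz
  exact hz

/-- Every cocycle is, on each finite set, a coboundary. -/
def LocTriv (L : Type) [Group L] : Prop :=
  ∀ (B : Type) (_ : AddCommGroup B) (f : L → L → B),
    (∀ c b a, f c b + f (c * b) a = f b a + f c (b * a)) → ∀ S : Set L, S.Finite →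
      ∃ φ : L → B, ∀ b ∈ S, ∀ a ∈ S, f b a = φ b - φ (b * a) + φ a

theorem H2_zero (hL : LocTriv L) : Subsingleton (grpHomology L 2) := by
  classical
  refine subsingleton_of_exact L 1 fun z hz => ?_
  let R := LinearMap.range (dd L 2)
  let f : L → L → Ch L 2 ⧸ R := fun b a => R.mkQ (Finsupp.single (sx2 L a b) 1)
  have hf : ∀ c b a, f c b + f (c * b) a = f b a + f c (b * a) := by
    intro c b a
    have : R.mkQ (dd L 2 (Finsupp.single (sx3 L a b c) 1)) = 0 := by
      rw [Submodule.mkQ_apply, Submodule.Quotient.mk_eq_zero]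
      exact ⟨_, rfl⟩
    rw [dd2, map_sub, map_add, map_sub] at this
    change f c b - f c (b * a) + f (c * b) a - f b a = 0 at this
    rw [← sub_eq_zero, ← this]
    abel
  obtain ⟨φ, hφ⟩ := hL _ inferInstance f hf
    ((z.support.image fun s => edg s 0 1 (by lia) (by lia)) ∪
      (z.support.image fun s => edg s 1 2 (by lia) (by lia)) : Finset L) (Finset.finite_toSet _)
  let Φ : Ch L 1 →ₗ[ℤ] Ch L 2 ⧸ R :=
    Finsupp.linearCombination ℤ (fun s => φ (edg s 0 1 (by lia) (by lia)))
  have hΦ : ∀ a, Φ (Finsupp.single (sx1 L a) 1) = φ a := by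
    intro a
    rw [Finsupp.linearCombination_single, one_smul]
    rfl
  have hzz : z = ∑ s ∈ z.support, z s • Finsupp.single s (1 : ℤ) := by
    conv_lhs => rw [← Finsupp.sum_single z]
    simp [Finsupp.sum]
  have key : R.mkQ z = Φ (dd L 1 z) := by
    rw [hzz, map_sum, map_sum, map_sum]
    refine Finset.sum_congr rfl fun s hs => ?_
    rw [map_smul, map_smul, map_smul]
    congr 1
    rw [sx2_eta L s, dd1, map_add, map_sub, hΦ, hΦ, hΦ]
    refine hφ _ ?_ _ ?_
    · rw [Finset.mem_coe, Finset.mem_union]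
      exact Or.inr (Finset.mem_image_of_mem _ hs)
    · rw [Finset.mem_coe, Finset.mem_union]
      exact Or.inl (Finset.mem_image_of_mem (fun s : ComposableArrows (SingleObj L) 2 => edg s 0 1 (by lia) (by lia)) hs)
  rw [hz, map_zero, Submodule.mkQ_apply, Submodule.Quotient.mk_eq_zero] at key
  exact key

end HomologyPart

section FinalPart
open Equiv

/-- The total space of the central extension defined by a cocycle. -/
def CExt (L B : Type) [Group L] [AddCommGroup B] (f : L → L → B)
    (_ : ∀ c b a, f c b + f (c * b) a = f b a + f c (b * a)) : Type := L × B

variable {L B : Type} [Group L] [AddCommGroup B] (f : L → L → B)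
    (hf : ∀ c b a, f c b + f (c * b) a = f b a + f c (b * a))

/-- The group structure on the extension. -/
@[reducible] def extGroup : Group (CExt L B f hf) :=
  letI : Mul (CExt L B f hf) := ⟨fun x y => (x.1 * y.1, x.2 + y.2 + f x.1 y.1)⟩
  letI : One (CExt L B f hf) := ⟨(1, - f 1 1)⟩
  letI : Inv (CExt L B f hf) := ⟨fun x => (x.1⁻¹, - x.2 - f x.1⁻¹ x.1 - f 1 1)⟩
  Group.ofLeftAxioms
    (by
      rintro ⟨c, x⟩ ⟨b, y⟩ ⟨a, z⟩
      refine Prod.ext (mul_assoc c b a) ?_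
      change x + y + f c b + z + f (c * b) a = x + (y + z + f b a) + f c (b * a)
      have := hf c b a
      calc _ = x + y + z + (f c b + f (c * b) a) := by abel
        _ = _ := by rw [this]; abel)
    (by
      rintro ⟨a, z⟩
      refine Prod.ext (one_mul a) ?_
      change - f 1 1 + z + f 1 a = z
      have := hf 1 1 a
      rw [one_mul, one_mul, add_left_inj] at this
      rw [this]; abel)
    (by
      rintro ⟨a, z⟩
      refine Prod.ext (inv_mul_cancel a) ?_
      change - z - f a⁻¹ a - f 1 1 + z + f a⁻¹ a = - f 1 1
      abel)

theorem ctbl_locTriv : LocTriv ctblPerm := by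
  intro B _ f hf S hS
  let _ := extGroup f hf
  let p : CExt ctblPerm B f hf →* ctblPerm := MonoidHom.mk' (fun x => x.1) (fun _ _ => rfl)
  have hp : Function.Surjective p := fun g => ⟨(g, 0), rfl⟩
  have f1 : ∀ a, f 1 a = f 1 1 := fun a => by
    have := hf 1 1 a
    rw [one_mul, one_mul, add_left_inj] at this
    exact this.symm
  have f2 : ∀ a, f a 1 = f 1 1 := fun a => by
    have := hf a 1 1
    rw [mul_one, mul_one, add_left_inj] at this
    exact this
  have hz : ∀ z, p z = 1 → ∀ x, z * x = x * z := by
    rintro ⟨z, u⟩ h ⟨x, v⟩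
    obtain rfl : z = 1 := h
    refine Prod.ext ((one_mul x).trans (mul_one x).symm) ?_
    change u + v + f 1 x = v + u + f x 1
    rw [f1 x, f2 x, add_comm u v]
  choose D hD hDs using fun g : ctblPerm => g.2
  have hA : (⋃ g ∈ S, D g).Countable := hS.countable.biUnion fun g _ => hD g
  obtain ⟨s, hs, hmul⟩ := exists_split p hp hz hA
  have hsup : ∀ g ∈ S, Supp (⋃ g ∈ S, D g) (g : Perm ℝ) := fun g hg =>
    (hDs g).mono (Set.subset_biUnion_of_mem (u := D) hg)
  refine ⟨fun g => - (s g).2, fun b hb a ha => ?_⟩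
  have h1 := congrArg Prod.snd (hmul b a (hsup b hb) (hsup a ha))
  have h2 : (s b).1 = b := hs b (hsup b hb)
  have h3 : (s a).1 = a := hs a (hsup a ha)
  change (s (b * a)).2 = (s b).2 + (s a).2 + f (s b).1 (s a).1 at h1
  rw [h2, h3] at h1
  change f b a = - (s b).2 - - (s (b * a)).2 + - (s a).2
  generalize (s (b * a)).2 = x at h1
  rw [h1]; abel

theorem LocTriv.congr {L L' : Type} [Group L] [Group L'] (e : L ≃* L') (h : LocTriv L') :
    LocTriv L := by
  intro B _ f hf S hS
  obtain ⟨φ, hφ⟩ := h B inferInstance (fun x y => f (e.symm x) (e.symm y))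
    (fun c b a => by simp only [map_mul]; exact hf _ _ _) (e '' S) (hS.image _)
  refine ⟨fun x => φ (e x), fun b hb a ha => ?_⟩
  have := hφ (e b) ⟨b, hb, rfl⟩ (e a) ⟨a, ha, rfl⟩
  simpa using this

theorem stg_congr {L L' : Type} [Group L] [Group L'] (e : L ≃* L')
    (h : StronglyTorsionGenerated L') : StronglyTorsionGenerated L := by
  intro n hn
  obtain ⟨g, hg, hN⟩ := h n hn
  refine ⟨e.symm g, ?_, ?_⟩
  · rw [← hg]; exact e.symm.orderOf_eq g
  · have := Subgroup.map_normalClosure {g} e.symm.toMonoidHom e.symm.surjective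
    rw [hN, ← MonoidHom.range_eq_map, MonoidHom.range_eq_top.2 e.symm.surjective] at this
    rw [this, Set.image_singleton]
    rfl

theorem map_commutator_le {L L' : Type} [Group L] [Group L'] (e : L →* L') :
    (commutator L).map e ≤ commutator L' := by
  rw [commutator_def, Subgroup.map_commutator, commutator_def]
  exact Subgroup.commutator_mono le_top le_top

theorem center_congr {L L' : Type} [Group L] [Group L'] (e : L ≃* L')
    (h : Subgroup.center L' = ⊥) : Subgroup.center L = ⊥ := by
  rw [eq_bot_iff]
  intro x hx
  have : e x ∈ Subgroup.center L' := by
    rw [Subgroup.mem_center_iff]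
    intro y
    have := Subgroup.mem_center_iff.1 hx (e.symm y)
    simpa using congrArg e this
  rw [h, Subgroup.mem_bot] at this
  simpa using this

end FinalPart

theorem abelianization_realization
    (M : Type) [AddCommGroup M] :
    ∃ (G : Type) (_ : Group G),
      Nonempty (Abelianization G ≃* Multiplicative M) ∧
      StronglyTorsionGenerated ↥(commutator G) ∧
      Subsingleton (grpHomology ↥(commutator G) 1) ∧
      Subsingleton (grpHomology ↥(commutator G) 2) ∧
      Subgroup.center ↥(commutator G) = ⊥ := by
  let K := ctblPerm
  let G := Multiplicative M × K
  have hcom : commutator G = (MonoidHom.fst (Multiplicative M) K).ker := by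
    apply le_antisymm
    · exact Abelianization.commutator_subset_ker _
    · rintro ⟨m, k⟩ hm
      obtain rfl : m = 1 := hm
      have h1 : (commutator K).map (MonoidHom.inr (Multiplicative M) K) ≤ commutator G := by
        rw [commutator_def, Subgroup.map_commutator, commutator_def]
        exact Subgroup.commutator_mono le_top le_top
      exact h1 ⟨k, ctbl_commutator k, rfl⟩
  let φ : commutator G →* K := (MonoidHom.snd (Multiplicative M) K).comp (commutator G).subtype
  have hφ : Function.Bijective φ := by
    constructor
    · rintro ⟨⟨m, k⟩, hx⟩ ⟨⟨m', k'⟩, hy⟩ h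
      rw [hcom] at hx hy
      obtain rfl : m = 1 := hx
      obtain rfl : m' = 1 := hy
      obtain rfl : k = k' := h
      rfl
    · intro k
      refine ⟨⟨(1, k), ?_⟩, rfl⟩
      rw [hcom]
      rfl
  let e : commutator G ≃* K := MulEquiv.ofBijective φ hφ
  refine ⟨G, inferInstance, ⟨?_⟩, stg_congr e ctbl_stg, H1_zero _ ?_,
    H2_zero _ (ctbl_locTriv.congr e), center_congr e ctbl_center⟩
  · exact (QuotientGroup.quotientMulEquivOfEq hcom).trans
      (QuotientGroup.quotientKerEquivOfSurjective (MonoidHom.fst (Multiplicative M) K)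
        Prod.fst_surjective)
  · intro g
    have h1 : (commutator K).map e.symm.toMonoidHom ≤ commutator (commutator G) :=
      map_commutator_le _
    exact h1 ⟨e g, ctbl_commutator _, e.symm_apply_apply g⟩
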